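/- arXiv:1501.01450 — 8 statements merged into one kernel-verified Lean document; each statement's English description precedes it below -/
import Mathlib

section
/- Let u > 0 and R > 0 be real numbers and set a = R/u. Define g : ℝ → ℝ by: g(θ) = −2π(u²/R)·cos θ if cos θ < −a; g(θ) = −2(u²/R)·cos θ·arccos((1/a)·cos θ) + 2·√(u² − (u²·cos θ/R)²) if −a ≤ cos θ ≤ a; and g(θ) = 0 if cos θ > a. Then ∫_{0}^{2π} g(θ) dθ = (8u²/R) · ∫_{0}^{min(1,a)} [ √((1−z²)/(a²−z²)) + √((a²−z²)/(1−z²)) ] dz. -/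
open Real MeasureTheory

lemma integral_comp_cos_eq_integral_comp_sin {f : ℝ → ℝ} (hf : Continuous f) :
    ∫ θ in (0 : ℝ)..(2 * π), f (cos θ) =
      2 * ∫ θ in (0 : ℝ)..(π / 2), (f (sin θ) + f (-sin θ)) := by
  have hint (c d : ℝ) : IntervalIntegrable (fun θ => f (cos θ)) volume c d :=
    (by fun_prop : Continuous fun θ => f (cos θ)).intervalIntegrable c d
  have h₁ : ∫ θ in (0 : ℝ)..(π / 2), f (cos θ) = ∫ θ in (0 : ℝ)..(π / 2), f (sin θ) := by
    have := intervalIntegral.integral_comp_sub_left (a := 0) (b := π / 2)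
      (fun θ => f (cos θ)) (π / 2)
    simpa [cos_pi_div_two_sub] using this.symm
  have h₂ : ∫ θ in (π / 2)..π, f (cos θ) = ∫ θ in (0 : ℝ)..(π / 2), f (-sin θ) := by
    have := intervalIntegral.integral_comp_add_right (a := 0) (b := π / 2)
      (fun θ => f (cos θ)) (π / 2)
    simpa [cos_add_pi_div_two] using this.symm
  have h₃ : ∫ θ in π..(2 * π), f (cos θ) = ∫ θ in (0 : ℝ)..π, f (cos θ) := by
    have := intervalIntegral.integral_comp_sub_left (a := 0) (b := π)
      (fun θ => f (cos θ)) (2 * π)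
    rw [show 2 * π - π = π by ring, sub_zero] at this
    simpa [cos_two_pi_sub] using this.symm
  rw [← intervalIntegral.integral_add_adjacent_intervals (hint 0 π) (hint π (2 * π)), h₃,
    ← intervalIntegral.integral_add_adjacent_intervals (hint 0 (π / 2)) (hint (π / 2) π),
    h₁, h₂, intervalIntegral.integral_add]
  · ring
  · exact (by fun_prop : Continuous fun θ => f (sin θ)).intervalIntegrable _ _
  · exact (by fun_prop : Continuous fun θ => f (-sin θ)).intervalIntegrable _ _

lemma sin_arcsin_eq_min {a : ℝ} (ha : 0 < a) : sin (arcsin a) = min 1 a := by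
  rcases le_total a 1 with h | h
  · rw [sin_arcsin (by linarith) h, min_eq_right h]
  · rw [arcsin_of_one_le h, sin_pi_div_two, min_eq_left h]

lemma sin_lt_of_mem_Ioo_arcsin {a θ : ℝ} (ha : 0 < a) (hθ : θ ∈ Set.Ioo 0 (arcsin a)) :
    sin θ < a := by
  have h := sin_lt_sin_of_lt_of_le_pi_div_two (by linarith [hθ.1, pi_pos])
    (arcsin_le_pi_div_two a) hθ.2
  rw [sin_arcsin_eq_min ha] at h
  exact h.trans_le (min_le_right _ _)

lemma hasDerivAt_cos_mul_arcsin_sin_div {a θ : ℝ} (ha : 0 < a)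
    (hθ : θ ∈ Set.Ioo 0 (arcsin a)) :
    HasDerivAt (fun θ => cos θ * arcsin (sin θ / a))
      (cos θ ^ 2 / √(a ^ 2 - sin θ ^ 2) - sin θ * arcsin (sin θ / a)) θ := by
  have hs := sin_lt_of_mem_Ioo_arcsin ha hθ
  have hs₀ : 0 < sin θ :=
    sin_pos_of_pos_of_lt_pi hθ.1 (by linarith [hθ.2, arcsin_le_pi_div_two a, pi_pos])
  have hlt : sin θ / a < 1 := (div_lt_one ha).2 hs
  have hpos : 0 < sin θ / a := by positivity
  have h := (hasDerivAt_cos θ).mul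
    ((hasDerivAt_arcsin (by linarith) hlt.ne).comp θ ((hasDerivAt_sin θ).div_const a))
  refine h.congr_deriv ?_
  have hsq : √(1 - (sin θ / a) ^ 2) = √(a ^ 2 - sin θ ^ 2) / a := by
    rw [show 1 - (sin θ / a) ^ 2 = (a ^ 2 - sin θ ^ 2) / a ^ 2 by field_simp,
      sqrt_div' _ (sq_nonneg a), sqrt_sq ha.le]
  have hne : √(a ^ 2 - sin θ ^ 2) ≠ 0 := (sqrt_pos.2 (by nlinarith)).ne'
  simp only [Function.comp_apply]
  rw [hsq]
  field_simp
  ring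

lemma integral_sin_mul_arcsin_add_sqrt {a : ℝ} (ha : 0 < a) :
    ∫ θ in (0 : ℝ)..(π / 2), (sin θ * arcsin (sin θ / a) + √(a ^ 2 - sin θ ^ 2)) =
      ∫ θ in (0 : ℝ)..(arcsin a),
        (cos θ ^ 2 / √(a ^ 2 - sin θ ^ 2) + √(a ^ 2 - sin θ ^ 2)) := by
  have hα : 0 ≤ arcsin a := arcsin_nonneg.2 ha.le
  have hp : Continuous fun θ => sin θ * arcsin (sin θ / a) := by fun_prop
  have hq : Continuous fun θ => √(a ^ 2 - sin θ ^ 2) := by fun_prop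
  have hderiv : ∀ θ ∈ Set.Ioo 0 (arcsin a),
      HasDerivAt (fun x => (∫ t in (0 : ℝ)..x, sin t * arcsin (sin t / a)) +
        cos x * arcsin (sin x / a)) (cos θ ^ 2 / √(a ^ 2 - sin θ ^ 2)) θ := by
    intro θ hθ
    have h := (hp.integral_hasStrictDerivAt 0 θ).hasDerivAt.add
      (hasDerivAt_cos_mul_arcsin_sin_div ha hθ)
    exact h.congr_deriv (by ring)
  have hcont : Continuous (fun x => (∫ t in (0 : ℝ)..x, sin t * arcsin (sin t / a)) +
        cos x * arcsin (sin x / a)) := by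
    refine Continuous.add ?_ (by fun_prop)
    exact intervalIntegral.continuous_primitive (fun c d => hp.intervalIntegrable c d) 0
  have hint : IntervalIntegrable (fun θ => cos θ ^ 2 / √(a ^ 2 - sin θ ^ 2)) volume
      0 (arcsin a) := by
    apply intervalIntegral.intervalIntegrable_deriv_of_nonneg hcont.continuousOn
    · rwa [min_eq_left hα, max_eq_right hα]
    · intro x _
      positivity
  have hftc := intervalIntegral.integral_eq_sub_of_hasDerivAt_of_le hα hcont.continuousOn
    hderiv hint
  have htail : ∫ θ in (arcsin a)..(π / 2),
      (sin θ * arcsin (sin θ / a) + √(a ^ 2 - sin θ ^ 2)) =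
        cos (arcsin a) * arcsin (sin (arcsin a) / a) := by
    rcases le_total 1 a with h | h
    · simp [arcsin_of_one_le h]
    · have hs : sin (arcsin a) = a := sin_arcsin (by linarith) h
      rw [hs, div_self ha.ne', arcsin_one]
      have : ∫ θ in (arcsin a)..(π / 2),
          (sin θ * arcsin (sin θ / a) + √(a ^ 2 - sin θ ^ 2)) =
          ∫ θ in (arcsin a)..(π / 2), sin θ * (π / 2) := by
        refine intervalIntegral.integral_congr fun θ hθ => ?_
        rw [Set.uIcc_of_le (arcsin_le_pi_div_two a)] at hθ
        have hle : a ≤ sin θ := by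
          rw [← hs]
          exact sin_le_sin_of_le_of_le_pi_div_two (by linarith [pi_pos]) hθ.2 hθ.1
        rw [arcsin_of_one_le ((one_le_div ha).2 hle), sqrt_eq_zero_of_nonpos (by nlinarith),
          add_zero]
      rw [this, intervalIntegral.integral_mul_const, integral_sin, cos_pi_div_two, sub_zero]
  have hpq : Continuous fun θ => sin θ * arcsin (sin θ / a) + √(a ^ 2 - sin θ ^ 2) := hp.add hq
  rw [← intervalIntegral.integral_add_adjacent_intervals (b := arcsin a)
      (hpq.intervalIntegrable _ _) (hpq.intervalIntegrable _ _), htail,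
    intervalIntegral.integral_add hint (hq.intervalIntegrable _ _), hftc,
    intervalIntegral.integral_add (hp.intervalIntegrable _ _) (hq.intervalIntegrable _ _)]
  simp
  ring

lemma integral_sqrt_div_add_sqrt_div {a : ℝ} (ha : 0 < a) :
    ∫ z in (0 : ℝ)..(min 1 a),
        (√((1 - z ^ 2) / (a ^ 2 - z ^ 2)) + √((a ^ 2 - z ^ 2) / (1 - z ^ 2))) =
      ∫ θ in (0 : ℝ)..(arcsin a),
        (cos θ ^ 2 / √(a ^ 2 - sin θ ^ 2) + √(a ^ 2 - sin θ ^ 2)) := by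
  have hα : 0 ≤ arcsin a := arcsin_nonneg.2 ha.le
  have hα' := arcsin_le_pi_div_two a
  have hmono : StrictMonoOn sin (Set.Icc 0 (arcsin a)) :=
    strictMonoOn_sin.mono (Set.Icc_subset_Icc (by linarith [pi_pos]) hα')
  have himage : sin '' Set.Icc 0 (arcsin a) = Set.Icc 0 (min 1 a) := by
    rw [continuous_sin.continuousOn.image_Icc_of_monotoneOn hα hmono.monotoneOn, sin_zero,
      sin_arcsin_eq_min ha]
  rw [intervalIntegral.integral_of_le (le_min zero_le_one ha.le),
    intervalIntegral.integral_of_le hα, ← integral_Icc_eq_integral_Ioc, ← himage,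
    integral_image_eq_integral_abs_deriv_smul measurableSet_Icc
      (fun θ _ => (hasDerivAt_sin θ).hasDerivWithinAt) hmono.injOn,
    integral_Icc_eq_integral_Ioo, integral_Ioc_eq_integral_Ioo]
  refine setIntegral_congr_fun measurableSet_Ioo fun θ hθ => ?_
  have hc : 0 < cos θ :=
    cos_pos_of_mem_Ioo ⟨by linarith [hθ.1, pi_pos], hθ.2.trans_le hα'⟩
  rw [← cos_sq', sqrt_div (sq_nonneg _), sqrt_div' _ (sq_nonneg _), sqrt_sq hc.le,
    abs_of_pos hc, smul_eq_mul]
  field_simp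

/-- the angular integral of the bad-region area derivative
`g(θ) = lim_{r→0} dA_{mn}/dr` over `[0, 2π]` equals `(8u²/R)` times the
`z`-integral appearing in Theorem 1. Here `u = R_n^{lb}` and `a = R/u`. -/
theorem angular_integral_of_bad_region_derivative
    (u R : ℝ) (hu : 0 < u) (hR : 0 < R) (a : ℝ) (ha : a = R / u)
    (g : ℝ → ℝ)
    (hg : ∀ θ : ℝ, g θ =
      if Real.cos θ < -a then
        -(2 * Real.pi) * (u ^ 2 / R) * Real.cos θ
      else if Real.cos θ ≤ a then
        -2 * (u ^ 2 / R) * Real.cos θ * Real.arccos ((1 / a) * Real.cos θ)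
          + 2 * Real.sqrt (u ^ 2 - (u ^ 2 * Real.cos θ / R) ^ 2)
      else 0) :
    ∫ θ in (0 : ℝ)..(2 * Real.pi), g θ =
      (8 * u ^ 2 / R) *
        ∫ z in (0 : ℝ)..(min 1 a),
          (Real.sqrt ((1 - z ^ 2) / (a ^ 2 - z ^ 2)) +
           Real.sqrt ((a ^ 2 - z ^ 2) / (1 - z ^ 2))) := by
  have ha₀ : 0 < a := ha ▸ div_pos hR hu
  have hgG (θ : ℝ) : g θ = (2 * u ^ 2 / R) *
      (-cos θ * arccos (cos θ / a) + √(a ^ 2 - cos θ ^ 2)) := by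
    rw [hg]
    split_ifs with h₁ h₂
    · rw [arccos_of_le_neg_one ((div_le_iff₀ ha₀).2 (by linarith)),
        sqrt_eq_zero_of_nonpos (by nlinarith)]
      ring
    · have hsq : √(u ^ 2 - (u ^ 2 * cos θ / R) ^ 2) = u ^ 2 / R * √(a ^ 2 - cos θ ^ 2) := by
        rw [show u ^ 2 - (u ^ 2 * cos θ / R) ^ 2 = (u ^ 2 / R) ^ 2 * (a ^ 2 - cos θ ^ 2) by
            rw [ha]; field_simp,
          sqrt_mul (sq_nonneg _), sqrt_sq (by positivity)]
      rw [hsq, one_div_mul_eq_div]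
      ring
    · push Not at h₂
      rw [arccos_of_one_le ((one_le_div ha₀).2 h₂.le), sqrt_eq_zero_of_nonpos (by nlinarith)]
      ring
  simp_rw [hgG]
  rw [intervalIntegral.integral_const_mul,
    integral_comp_cos_eq_integral_comp_sin
      (f := fun c => -c * arccos (c / a) + √(a ^ 2 - c ^ 2)) (by fun_prop),
    integral_sqrt_div_add_sqrt_div ha₀, ← integral_sin_mul_arcsin_add_sqrt ha₀]
  have hsum (θ : ℝ) : -sin θ * arccos (sin θ / a) + √(a ^ 2 - sin θ ^ 2) +
      (-(-sin θ) * arccos (-sin θ / a) + √(a ^ 2 - (-sin θ) ^ 2)) =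
      2 * (sin θ * arcsin (sin θ / a) + √(a ^ 2 - sin θ ^ 2)) := by
    rw [neg_div, arccos_neg, arccos_eq_pi_div_two_sub_arcsin, neg_sq]
    ring
  simp_rw [hsum]
  rw [intervalIntegral.integral_const_mul]
  ring
end

section
/- Fix N ≥ 1 and positive reals λ_1,…,λ_N (densities), P_1,…,P_N and B_1,…,B_N (powers and bias factors), and α_1,…,α_N > 0 (path-loss exponents). For indices m, n ∈ {1,…,N}, define for R > 0 the distance lower bounds R_{i|m}(R) = (P_iB_i/(P_mB_m))^{1/α_i} · R^{α_m/α_i} for each i, and define F(m,n) = 8 λ_n λ_m ∫_{0}^{∞} ( ∫_{0}^{min(1, R/R_{n|m}(R))} [ √((1−z²)/((R/R_{n|m}(R))²−z²)) + √(((R/R_{n|m}(R))²−z²)/(1−z²)) ] dz ) · (R_{n|m}(R))² · exp( −π Σ_{i=1}^{N} λ_i (R_{i|m}(R))² ) dR. If α_m = α_n, then F(m,n) = F(n,m). -/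
open Real MeasureTheory

/-- The substitution `z ↦ c z` in the inner handover integral. -/
lemma integral_sqrt_ratio_add_eq_mul_inv {c : ℝ} (hc : 0 < c) :
    (∫ z in (0 : ℝ)..(min 1 c),
      (√((1 - z ^ 2) / (c ^ 2 - z ^ 2)) + √((c ^ 2 - z ^ 2) / (1 - z ^ 2)))) =
    c * ∫ z in (0 : ℝ)..(min 1 c⁻¹),
      (√((1 - z ^ 2) / (c⁻¹ ^ 2 - z ^ 2)) + √((c⁻¹ ^ 2 - z ^ 2) / (1 - z ^ 2))) := by
  have hb : min 1 c = c * min 1 c⁻¹ := by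
    rw [mul_min_of_nonneg _ _ hc.le, mul_one, mul_inv_cancel₀ hc.ne', min_comm]
  have hc2 : c ^ 2 ≠ 0 := by positivity
  have h := intervalIntegral.mul_integral_comp_mul_left (a := 0) (b := min 1 c⁻¹)
    (f := fun z : ℝ ↦ √((1 - z ^ 2) / (c ^ 2 - z ^ 2)) + √((c ^ 2 - z ^ 2) / (1 - z ^ 2))) c
  rw [mul_zero, ← hb] at h
  rw [← h]
  congr 2
  ext z
  have h1 : 1 - (c * z) ^ 2 = c ^ 2 * (c⁻¹ ^ 2 - z ^ 2) := by field_simp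
  have h2 : c ^ 2 - (c * z) ^ 2 = c ^ 2 * (1 - z ^ 2) := by ring
  rw [h1, h2, mul_div_mul_left _ _ hc2, mul_div_mul_left _ _ hc2, add_comm]

/-- Corollary 1: with distance lower bounds
`R_{i|m}(R) = (P_iB_i/(P_mB_m))^{1/α_i} R^{α_m/α_i}` and the handover-rate
integral `F(m,n)` of Theorem 1, if tiers `m` and `n` share the same path-loss
exponent then `F(m,n) = F(n,m)` (forward and reverse handover rates agree). -/
theorem forward_reverse_handover_rates_equal
    (N : ℕ) (hN : 1 ≤ N)
    (lam P B α : Fin N → ℝ)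
    (hlam : ∀ i, 0 < lam i) (hP : ∀ i, 0 < P i)
    (hB : ∀ i, 0 < B i) (hα : ∀ i, 0 < α i)
    (Rlb : Fin N → Fin N → ℝ → ℝ)
    (hRlb : ∀ i m (R : ℝ),
      Rlb i m R = ((P i * B i) / (P m * B m)) ^ (1 / α i) * R ^ (α m / α i))
    (F : Fin N → Fin N → ℝ)
    (hF : ∀ m n, F m n = 8 * lam n * lam m *
      ∫ R in Set.Ioi (0 : ℝ),
        (∫ z in (0 : ℝ)..(min 1 (R / Rlb n m R)),
            (Real.sqrt ((1 - z ^ 2) / ((R / Rlb n m R) ^ 2 - z ^ 2)) +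
             Real.sqrt (((R / Rlb n m R) ^ 2 - z ^ 2) / (1 - z ^ 2)))) *
          (Rlb n m R) ^ 2 *
          Real.exp (-Real.pi * ∑ i, lam i * (Rlb i m R) ^ 2))
    (m n : Fin N) (hmn : α m = α n) :
    F m n = F n m := by
  set c : ℝ := ((P n * B n) / (P m * B m)) ^ (1 / α n) with hc_def
  have hQ (i : Fin N) : 0 < P i * B i := mul_pos (hP i) (hB i)
  have hc : 0 < c := rpow_pos_of_pos (div_pos (hQ n) (hQ m)) _
  have hαn := (hα n).ne'
  have hnm (R : ℝ) : Rlb n m R = c * R := by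
    rw [hRlb, hmn, div_self hαn, rpow_one]
  have hmn' (R : ℝ) : Rlb m n R = c⁻¹ * R := by
    rw [hRlb, hmn, div_self hαn, rpow_one, hc_def,
      ← inv_rpow (div_pos (hQ n) (hQ m)).le, inv_div]
  have hscale (i : Fin N) {R : ℝ} (hR : 0 < R) : Rlb i n (c * R) = Rlb i m R := by
    rw [hRlb, hRlb, mul_rpow hc.le hR.le, hmn, hc_def,
      ← rpow_mul (div_pos (hQ n) (hQ m)).le, ← mul_assoc,
      one_div_mul_eq_div, div_div_cancel_left' hαn, one_div,
      ← mul_rpow (div_pos (hQ i) (hQ n)).le (div_pos (hQ n) (hQ m)).le,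
      div_mul_div_cancel₀ (hQ n).ne']
  rw [hF, hF, mul_right_comm 8 (lam m) (lam n)]
  congr 1
  have hsub := integral_comp_mul_left_Ioi (fun R ↦
    (∫ z in (0 : ℝ)..(min 1 (R / Rlb m n R)),
      (√((1 - z ^ 2) / ((R / Rlb m n R) ^ 2 - z ^ 2)) +
        √(((R / Rlb m n R) ^ 2 - z ^ 2) / (1 - z ^ 2)))) *
      (Rlb m n R) ^ 2 * exp (-π * ∑ i, lam i * (Rlb i n R) ^ 2)) 0 hc
  rw [mul_zero, smul_eq_mul, eq_inv_mul_iff_mul_eq₀ hc.ne'] at hsub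
  rw [← hsub, ← integral_const_mul]
  refine setIntegral_congr_fun measurableSet_Ioi fun R (hR : 0 < R) ↦ ?_
  have hratio : R / Rlb n m R = c⁻¹ := by rw [hnm]; field_simp
  have hratio' : c * R / R = c := mul_div_cancel_right₀ c hR.ne'
  have hRm : Rlb m m R = R := by
    rw [← hscale m hR, hmn', inv_mul_cancel_left₀ hc.ne']
  simp only [hratio, hscale _ hR, hRm, hratio']
  rw [integral_sqrt_ratio_add_eq_mul_inv hc, hnm]
  ring
end

section
/- For every real β > 0, J(β) = β · J(1/β); explicitly, ∫_{0}^{min(1,β)} [ √((1−z²)/(β²−z²)) + √((β²−z²)/(1−z²)) ] dz = β · ∫_{0}^{min(1,1/β)} [ √((1−z²)/(β^{−2}−z²)) + √((β^{−2}−z²)/(1−z²)) ] dz. -/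
open Real MeasureTheory

/-- the substitution identity `J(β) = β · J(1/β)` for the
`z`-integral of Appendix D (proof of Corollary 1). -/
theorem J_substitution_identity (β : ℝ) (hβ : 0 < β) :
    ∫ z in (0 : ℝ)..(min 1 β),
        (Real.sqrt ((1 - z ^ 2) / (β ^ 2 - z ^ 2)) +
         Real.sqrt ((β ^ 2 - z ^ 2) / (1 - z ^ 2)))
      = β * ∫ z in (0 : ℝ)..(min 1 (1 / β)),
          (Real.sqrt ((1 - z ^ 2) / ((β ^ 2)⁻¹ - z ^ 2)) +
           Real.sqrt (((β ^ 2)⁻¹ - z ^ 2) / (1 - z ^ 2))) := by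
  have hβ' : β ^ 2 ≠ 0 := by positivity
  have hmin : β * min 1 (1 / β) = min 1 β := by
    rw [mul_min_of_nonneg _ _ hβ.le, mul_one, mul_one_div_cancel hβ.ne', min_comm]
  have hscale : ∀ z : ℝ, 1 - (β * z) ^ 2 = β ^ 2 * ((β ^ 2)⁻¹ - z ^ 2) := fun z => by
    rw [mul_sub, mul_inv_cancel₀ hβ', mul_pow]
  have hscale' : ∀ z : ℝ, β ^ 2 - (β * z) ^ 2 = β ^ 2 * (1 - z ^ 2) := fun z => by ring
  conv_lhs => rw [← hmin, ← mul_zero β, ← intervalIntegral.mul_integral_comp_mul_left]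
  simp only [hscale, hscale', mul_div_mul_left _ _ hβ', add_comm]
end

section
/- Let r > 0, R_{mk} > 0, R_{nj} > 0, θ_{mk}, θ_{nj} ∈ ℝ, α_m, α_n > 0 and P_m, P_n, B_m, B_n, L_0 > 0. Set d_m² = R_{mk}² − 2 r R_{mk} cos θ_{mk} + r², d_n² = R_{nj}² − 2 r R_{nj} cos θ_{nj} + r², and assume d_m² > 0 and d_n² > 0. Define x_{nj} = r² − (B_nP_n/(B_mP_m))^{2/α_n} · (d_m²)^{α_m/α_n}. Then P_m B_m L_0 (d_m²)^{−α_m/2} ≥ P_n B_n L_0 (d_n²)^{−α_n/2} if and only if cos θ_{nj} ≤ (R_{nj}² + x_{nj}) / (2 r R_{nj}). -/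
open Real

/-- Comparing two weighted negative powers amounts to comparing one base with an explicit
threshold depending on the other. -/
theorem mul_rpow_neg_half_le_iff {a b u v s t : ℝ} (ha : 0 < a) (hb : 0 < b)
    (hu : 0 < u) (hv : 0 < v) (ht : 0 < t) :
    b * v ^ (-(t / 2)) ≤ a * u ^ (-(s / 2)) ↔ (b / a) ^ (2 / t) * u ^ (s / t) ≤ v := by
  have hq : 0 < b / a := div_pos hb ha
  have hpow : ((b / a) ^ (2 / t) * u ^ (s / t)) ^ (t / 2) = b / a * u ^ (s / 2) := by
    rw [mul_rpow (by positivity) (by positivity), ← rpow_mul hq.le, ← rpow_mul hu.le]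
    have h₁ : 2 / t * (t / 2) = 1 := by field_simp
    have h₂ : s / t * (t / 2) = s / 2 := by field_simp
    rw [h₁, h₂, rpow_one]
  rw [← rpow_le_rpow_iff (by positivity) hv.le (half_pos ht), hpow,
    rpow_neg hv.le, rpow_neg hu.le, ← div_eq_mul_inv, ← div_eq_mul_inv,
    div_le_div_iff₀ (by positivity) (by positivity), div_mul_eq_mul_div, div_le_iff₀ ha,
    mul_comm a]

/-- equations (8)–(10): after the user moves a distance `r`,
it keeps its link to the serving tier-`m` base station against a tier-`n`
base station iff `cos θ_{nj} ≤ (R_{nj}² + x_{nj})/(2 r R_{nj})`. -/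
theorem keep_link_iff_cos_bound
    (r Rmk Rnj θmk θnj αm αn Pm Pn Bm Bn L0 : ℝ)
    (hr : 0 < r) (hRmk : 0 < Rmk) (hRnj : 0 < Rnj)
    (hαm : 0 < αm) (hαn : 0 < αn)
    (hPm : 0 < Pm) (hPn : 0 < Pn) (hBm : 0 < Bm) (hBn : 0 < Bn) (hL0 : 0 < L0)
    (dm2 dn2 : ℝ)
    (hdm2 : dm2 = Rmk ^ 2 - 2 * r * Rmk * Real.cos θmk + r ^ 2)
    (hdn2 : dn2 = Rnj ^ 2 - 2 * r * Rnj * Real.cos θnj + r ^ 2)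
    (hdm2pos : 0 < dm2) (hdn2pos : 0 < dn2)
    (x : ℝ)
    (hx : x = r ^ 2 - ((Bn * Pn) / (Bm * Pm)) ^ (2 / αn) * dm2 ^ (αm / αn)) :
    Pm * Bm * L0 * dm2 ^ (-(αm / 2)) ≥ Pn * Bn * L0 * dn2 ^ (-(αn / 2)) ↔
      Real.cos θnj ≤ (Rnj ^ 2 + x) / (2 * r * Rnj) := by
  have hquot : Pn * Bn * L0 / (Pm * Bm * L0) = Bn * Pn / (Bm * Pm) := by
    field_simp
  rw [ge_iff_le, mul_rpow_neg_half_le_iff (by positivity) (by positivity) hdm2pos hdn2pos hαn,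
    hquot, le_div_iff₀ (by positivity), hx, hdn2]
  constructor <;> intro h <;> linarith
end

section
/- Fix β > 0, R₀ > 0, θ ∈ ℝ, and for r ≥ 0 define x(r) = r² − β²(R₀² − 2 r R₀ cos θ + r²) and φ^d(r) = −r + √(r² − x(r)). If cos θ > −1/β, then there exists ε > 0 such that φ^d(r) < βR₀ for all r ∈ (0, ε); if cos θ < −1/β, then there exists ε > 0 such that φ^d(r) > βR₀ for all r ∈ (0, ε). -/
open Real

/-- equation (37) of Appendix A: comparison of
`φ^d(r) = −r + √(r² − x(r))` with the distance lower bound `βR₀`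
for small `r > 0`, according to the sign of `cos θ + 1/β`. -/
theorem phi_d_vs_lower_bound
    (β R₀ θ : ℝ) (hβ : 0 < β) (hR₀ : 0 < R₀)
    (x φd : ℝ → ℝ)
    (hx : ∀ r : ℝ, x r = r ^ 2 - β ^ 2 * (R₀ ^ 2 - 2 * r * R₀ * Real.cos θ + r ^ 2))
    (hφd : ∀ r : ℝ, φd r = -r + Real.sqrt (r ^ 2 - x r)) :
    (Real.cos θ > -(1 / β) →
      ∃ ε > (0 : ℝ), ∀ r ∈ Set.Ioo (0 : ℝ) ε, φd r < β * R₀) ∧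
    (Real.cos θ < -(1 / β) →
      ∃ ε > (0 : ℝ), ∀ r ∈ Set.Ioo (0 : ℝ) ε, φd r > β * R₀) := by
  have key : ∀ r, r ^ 2 - x r = β ^ 2 * (R₀ ^ 2 - 2 * r * R₀ * Real.cos θ + r ^ 2) := by
    intro r
    rw [hx]
    ring
  constructor
  · intro h
    have hc : 0 < β * Real.cos θ + 1 := by
      have h' := mul_lt_mul_of_pos_left h hβ
      have : β * -(1 / β) = -1 := by field_simp
      linarith
    refine ⟨2 * β * R₀ * (β * Real.cos θ + 1) / β ^ 2, by positivity, ?_⟩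
    rintro r ⟨hr, hrε⟩
    rw [lt_div_iff₀ (by positivity)] at hrε
    have hlt := mul_lt_mul_of_pos_left hrε hr
    have hsqrt : Real.sqrt (r ^ 2 - x r) < β * R₀ + r := by
      rw [Real.sqrt_lt' (by positivity), key]
      nlinarith [sq_nonneg r]
    rw [hφd]
    linarith
  · intro h
    have hc : 0 < -(β * Real.cos θ + 1) := by
      have h' := mul_lt_mul_of_pos_left h hβ
      have : β * -(1 / β) = -1 := by field_simp
      linarith
    refine ⟨2 * β * R₀ * -(β * Real.cos θ + 1), by positivity, ?_⟩
    rintro r ⟨hr, hrε⟩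
    have hlt := mul_lt_mul_of_pos_left hrε hr
    have hsqrt : β * R₀ + r < Real.sqrt (r ^ 2 - x r) := by
      rw [Real.lt_sqrt (by positivity), key]
      nlinarith [sq_nonneg (β * r)]
    rw [hφd]
    linarith
end

section
/- Fix β > 0, R₀ > 0, θ ∈ ℝ, and for r ≥ 0 define x(r) = r² − β²(R₀² − 2 r R₀ cos θ + r²) and φ^d(r) = −r + √(r² − x(r)). Then lim_{r→0⁺} π·(φ^d(r)² − β²R₀²)/r = −2π β R₀ (β cos θ + 1). -/
open Real Filter

/-- equation (45) of Appendix B: the limit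
`lim_{r→0⁺} π(φ^d(r)² − β²R₀²)/r = −2πβR₀(β cos θ + 1)`, i.e. the derivative
at `0` of the full-annulus part `A³(r) = π(φ^d(r)² − β²R₀²)` of the bad region. -/
theorem annulus_area_derivative
    (β R₀ θ : ℝ) (hβ : 0 < β) (hR₀ : 0 < R₀)
    (x φd : ℝ → ℝ)
    (hx : ∀ r : ℝ, x r = r ^ 2 - β ^ 2 * (R₀ ^ 2 - 2 * r * R₀ * Real.cos θ + r ^ 2))
    (hφd : ∀ r : ℝ, φd r = -r + Real.sqrt (r ^ 2 - x r)) :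
    Filter.Tendsto (fun r => Real.pi * ((φd r) ^ 2 - β ^ 2 * R₀ ^ 2) / r)
      (nhdsWithin 0 (Set.Ioi 0))
      (nhds (-(2 * Real.pi * β * R₀ * (β * Real.cos θ + 1)))) := by
  have hq (r : ℝ) : 0 ≤ R₀ ^ 2 - 2 * r * R₀ * Real.cos θ + r ^ 2 := by
    nlinarith [sq_nonneg (r - R₀ * Real.cos θ),
      mul_nonneg (sq_nonneg R₀) (sub_nonneg.2 (Real.cos_sq_le_one θ))]
  have hcont : Continuous fun r : ℝ => Real.pi * (r
      - 2 * Real.sqrt (β ^ 2 * (R₀ ^ 2 - 2 * r * R₀ * Real.cos θ + r ^ 2))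
      + β ^ 2 * (r - 2 * R₀ * Real.cos θ)) := by fun_prop
  have hlim := (hcont.tendsto 0).mono_left (nhdsWithin_le_nhds (s := Set.Ioi 0))
  have hsqrt : Real.sqrt (β ^ 2 * R₀ ^ 2) = β * R₀ := by
    rw [← mul_pow, Real.sqrt_sq (by positivity)]
  have hval : Real.pi * ((0 : ℝ)
      - 2 * Real.sqrt (β ^ 2 * (R₀ ^ 2 - 2 * 0 * R₀ * Real.cos θ + 0 ^ 2))
      + β ^ 2 * (0 - 2 * R₀ * Real.cos θ))
      = -(2 * Real.pi * β * R₀ * (β * Real.cos θ + 1)) := by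
    rw [show R₀ ^ 2 - 2 * 0 * R₀ * Real.cos θ + 0 ^ 2 = R₀ ^ 2 by ring, hsqrt]
    ring
  rw [hval] at hlim
  refine hlim.congr' ?_
  filter_upwards [self_mem_nhdsWithin] with r hr
  have hr0 : r ≠ 0 := ne_of_gt hr
  have hsq := Real.sq_sqrt (mul_nonneg (sq_nonneg β) (hq r))
  rw [hφd, hx, sub_sub_cancel, eq_div_iff hr0]
  linear_combination -Real.pi * hsq
end

section
/- Fix β > 0, R₀ > 0, θ ∈ ℝ with |cos θ| < min(1, 1/β), and for r ≥ 0 define x(r) = r² − β²(R₀² − 2 r R₀ cos θ + r²) and φ^u(r) = r + √(r² − x(r)). Then lim_{r→0⁺} (1/r) · ∫_{βR₀}^{φ^u(r)} 2s · arccos( (s² + x(r)) / (2rs) ) ds = −2β²R₀ cos θ · arccos(β cos θ) + 2βR₀ · √(1 − β²cos²θ). -/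
open Real Filter MeasureTheory

theorem integral_arccos_to_one {a : ℝ} (h₁ : -1 ≤ a) (h₂ : a ≤ 1) :
    ∫ u in a..1, Real.arccos u = Real.sqrt (1 - a ^ 2) - a * Real.arccos a := by
  have hcont : Continuous fun u : ℝ => u * Real.arccos u - Real.sqrt (1 - u ^ 2) := by
    fun_prop
  rw [intervalIntegral.integral_eq_sub_of_hasDerivAt_of_le h₂ hcont.continuousOn
    (fun u hu => ?_) (Real.continuous_arccos.intervalIntegrable _ _)]
  · simp
  · have hpos : 0 < 1 - u ^ 2 := by nlinarith [hu.1, hu.2]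
    have hsq : HasDerivAt (fun u : ℝ => 1 - u ^ 2) (-(2 * u)) u := by
      simpa using (hasDerivAt_pow 2 u).const_sub 1
    have hd := ((hasDerivAt_id u).mul
      (Real.hasDerivAt_arccos (by linarith [hu.1]) hu.2.ne)).sub (hsq.sqrt hpos.ne')
    refine hd.congr_deriv ?_
    have := (Real.sqrt_pos.2 hpos).ne'
    simp only [id]
    field_simp
    ring

/-- Continuity of an integral jointly in a parameter and in its upper endpoint. -/
theorem continuous_integral_param_endpoint {F : ℝ → ℝ → ℝ}
    (hF : Continuous (Function.uncurry F)) :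
    Continuous fun p : ℝ × ℝ => ∫ t in (0 : ℝ)..p.2, F p.1 t := by
  refine intervalIntegral.continuous_parametric_intervalIntegral_of_continuous
    (f := fun (p : ℝ × ℝ) t => F p.1 t) ?_ continuous_snd
  exact hF.comp ((continuous_fst.comp continuous_fst).prodMk continuous_snd)

/-- The affine substitution `s = b + r t` on an interval starting at `b`. -/
theorem one_div_mul_integral_eq_integral_comp_add_mul (f : ℝ → ℝ) {r : ℝ} (hr : r ≠ 0)
    (b d : ℝ) :
    (1 / r) * ∫ s in b..d, f s = ∫ t in (0 : ℝ)..((d - b) / r), f (b + r * t) := by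
  rw [intervalIntegral.integral_comp_add_mul f hr, mul_zero, add_zero, mul_div_cancel₀ _ hr,
    add_sub_cancel, smul_eq_mul, one_div]

/-- The slope at `0` of the distance-type function `r + β √(R² - 2 r R c + r²)`. -/
theorem tendsto_slope_add_sqrt {β R : ℝ} (c : ℝ) (hβ : 0 < β) (hR : 0 < R) :
    Tendsto (fun r : ℝ => (r + Real.sqrt (β ^ 2 * (R ^ 2 - 2 * r * R * c + r ^ 2)) - β * R) / r)
      (nhdsWithin 0 (Set.Ioi 0)) (nhds (1 - β * c)) := by
  have hpoly : HasDerivAt (fun r : ℝ => β ^ 2 * (R ^ 2 - 2 * r * R * c + r ^ 2))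
      (β ^ 2 * (-(2 * R * c))) 0 := by
    have h := ((((hasDerivAt_id (0 : ℝ)).const_mul 2).mul_const R).mul_const c).const_sub (R ^ 2)
    refine ((h.add (hasDerivAt_pow 2 (0 : ℝ))).const_mul (β ^ 2)).congr_deriv ?_
    simp
  have hval : Real.sqrt (β ^ 2 * (R ^ 2 - 2 * 0 * R * c + 0 ^ 2)) = β * R := by
    rw [show β ^ 2 * (R ^ 2 - 2 * 0 * R * c + 0 ^ 2) = (β * R) ^ 2 by ring,
      Real.sqrt_sq (by positivity)]
  have hd := (hasDerivAt_id (0 : ℝ)).add (hpoly.sqrt (by simp [hβ.ne', hR.ne']))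
  rw [hval] at hd
  have ht := (hasDerivAt_iff_tendsto_slope.1 hd).mono_left
    (nhdsWithin_mono 0 fun r (hr : 0 < r) => hr.ne')
  have hlim : 1 + β ^ 2 * (-(2 * R * c)) / (2 * (β * R)) = 1 - β * c := by
    field_simp
    ring
  rw [hlim] at ht
  refine ht.congr fun r => ?_
  simp only [slope_def_field, Pi.add_apply, id, hval]
  ring

/-- equation (43) of Appendix B: in the case
`|cos θ| < min(1, 1/β)`, the derivative at `r = 0` of the bad-region area
`A¹(r) = ∫_{βR₀}^{φ^u(r)} 2s·arccos((s² + x(r))/(2rs)) ds` equals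
`−2β²R₀ cos θ · arccos(β cos θ) + 2βR₀ √(1 − β²cos²θ)`. -/
theorem sector_area_derivative_middle_case
    (β R₀ θ : ℝ) (hβ : 0 < β) (hR₀ : 0 < R₀)
    (hθ : |Real.cos θ| < min 1 (1 / β))
    (x φu : ℝ → ℝ)
    (hx : ∀ r : ℝ, x r = r ^ 2 - β ^ 2 * (R₀ ^ 2 - 2 * r * R₀ * Real.cos θ + r ^ 2))
    (hφu : ∀ r : ℝ, φu r = r + Real.sqrt (r ^ 2 - x r)) :
    Filter.Tendsto
      (fun r => (1 / r) *
        ∫ s in (β * R₀)..(φu r),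
          2 * s * Real.arccos ((s ^ 2 + x r) / (2 * r * s)))
      (nhdsWithin 0 (Set.Ioi 0))
      (nhds (-(2 * β ^ 2 * R₀ * Real.cos θ) * Real.arccos (β * Real.cos θ)
        + 2 * β * R₀ * Real.sqrt (1 - β ^ 2 * (Real.cos θ) ^ 2))) := by
  set c := Real.cos θ
  have hβc : |β * c| < 1 := by
    rw [abs_mul, abs_of_pos hβ, mul_comm]
    exact (lt_div_iff₀ hβ).1 (hθ.trans_le (min_le_right _ _))
  obtain ⟨hlo, hhi⟩ := abs_lt.1 hβc
  have hslope : Tendsto (fun r => (φu r - β * R₀) / r) (nhdsWithin 0 (Set.Ioi 0))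
      (nhds (1 - β * c)) := by
    refine (tendsto_slope_add_sqrt c hβ hR₀).congr fun r => ?_
    rw [hφu, hx, sub_sub_cancel]
  -- The absolute values make the rescaled integrand continuous everywhere.
  let F : ℝ → ℝ → ℝ := fun r t => 2 * (β * R₀ + |r| * |t|) *
    Real.arccos ((2 * β * R₀ * t + r * t ^ 2 + r + 2 * β ^ 2 * R₀ * c - β ^ 2 * r) /
      (2 * (β * R₀ + |r| * |t|)))
  have hF : Continuous (Function.uncurry F) := by
    have hden : ∀ p : ℝ × ℝ, 2 * (β * R₀ + |p.1| * |p.2|) ≠ 0 := fun p => by positivity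
    exact (by fun_prop : Continuous fun p : ℝ × ℝ => 2 * (β * R₀ + |p.1| * |p.2|)).mul
      (Real.continuous_arccos.comp (Continuous.div (by fun_prop) (by fun_prop) hden))
  have hF0 : ∫ t in (0 : ℝ)..(1 - β * c), F 0 t =
      -(2 * β ^ 2 * R₀ * c) * Real.arccos (β * c)
        + 2 * β * R₀ * Real.sqrt (1 - β ^ 2 * c ^ 2) := by
    have hint : ∀ t, F 0 t = 2 * (β * R₀) * Real.arccos (t + β * c) := fun t => by
      simp only [F, abs_zero, zero_mul, add_zero, mul_zero, sub_zero]
      congr 2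
      field_simp
    simp only [hint]
    rw [intervalIntegral.integral_const_mul,
      intervalIntegral.integral_comp_add_right (fun u => Real.arccos u), zero_add,
      sub_add_cancel, integral_arccos_to_one hlo.le hhi.le, mul_pow]
    ring
  have hr0 : Tendsto (fun r : ℝ => r) (nhdsWithin 0 (Set.Ioi 0)) (nhds 0) :=
    tendsto_id.mono_left nhdsWithin_le_nhds
  have hlim := ((continuous_integral_param_endpoint hF).tendsto (0, 1 - β * c)).comp
    (hr0.prodMk_nhds hslope)
  simp only [hF0] at hlim
  refine hlim.congr' ?_
  filter_upwards [self_mem_nhdsWithin, hslope.eventually_const_lt (sub_pos.2 hhi)]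
    with r (hr : 0 < r) hT
  rw [one_div_mul_integral_eq_integral_comp_add_mul _ hr.ne']
  refine intervalIntegral.integral_congr fun t ht => ?_
  rw [Set.uIcc_of_le hT.le] at ht
  have hs : 0 < β * R₀ + r * t := by have := ht.1; positivity
  simp only [abs_of_pos hr, abs_of_nonneg ht.1, hx]
  congr 2
  rw [div_eq_div_iff (by positivity) (by positivity)]
  ring
end

section
/- Fix β > 1, R₀ > 0, θ ∈ ℝ with cos θ < −1/β, and for r ≥ 0 define x(r) = r² − β²(R₀² − 2 r R₀ cos θ + r²), φ^d(r) = −r + √(r² − x(r)) and φ^u(r) = r + √(r² − x(r)). Then lim_{r→0⁺} (1/r) · [ π(φ^d(r)² − β²R₀²) + ∫_{φ^d(r)}^{φ^u(r)} 2s · arccos( (s² + x(r)) / (2rs) ) ds ] = −2π β² R₀ cos θ. -/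
open Real Filter MeasureTheory

theorem integral_arccos_neg_one_one : ∫ t in (-1 : ℝ)..1, arccos t = π := by
  have h : ∫ t in (-1 : ℝ)..1, arccos (-t) = ∫ t in (-1 : ℝ)..1, arccos t := by
    simp [intervalIntegral.integral_comp_neg (fun t => arccos t)]
  simp only [arccos_neg] at h
  rw [intervalIntegral.integral_sub intervalIntegrable_const
    (continuous_arccos.intervalIntegrable _ _), intervalIntegral.integral_const, smul_eq_mul] at h
  linarith

/-- The sector integral between the circles of radii `w r - r` and `w r + r`, divided by `r`,
tends to `2 * π * w 0`. -/
theorem tendsto_inv_mul_sector_integral {w : ℝ → ℝ} (hw : ContinuousAt w 0) (hw0 : 0 < w 0) :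
    Tendsto (fun r => r⁻¹ * ∫ s in (w r - r)..(w r + r),
        2 * s * arccos ((s ^ 2 + (r ^ 2 - w r ^ 2)) / (2 * r * s)))
      (nhdsWithin 0 (Set.Ioi 0)) (nhds (2 * π * w 0)) := by
  have hw' : Tendsto w (nhdsWithin 0 (Set.Ioi 0)) (nhds (w 0)) :=
    hw.tendsto.mono_left nhdsWithin_le_nhds
  have hid : Tendsto (fun r : ℝ => r) (nhdsWithin 0 (Set.Ioi 0)) (nhds 0) :=
    tendsto_id.mono_left nhdsWithin_le_nhds
  have hpos : ∀ᶠ r in nhdsWithin (0 : ℝ) (Set.Ioi 0), r < w r :=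
    hid.eventually_lt hw' hw0
  have hbdd : ∀ᶠ r in nhdsWithin (0 : ℝ) (Set.Ioi 0), w r < w 0 + 1 :=
    hw'.eventually_lt_const (by linarith)
  have hself : ∀ᶠ r in nhdsWithin (0 : ℝ) (Set.Ioi 0), 0 < r :=
    eventually_mem_nhdsWithin
  have key : Tendsto (fun r => ∫ t in (-1 : ℝ)..1, 2 * (w r + r * t) *
        arccos ((2 * w r * t + r * (t ^ 2 + 1)) / (2 * (w r + r * t))))
      (nhdsWithin 0 (Set.Ioi 0)) (nhds (∫ t in (-1 : ℝ)..1, 2 * w 0 * arccos t)) := by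
    refine intervalIntegral.tendsto_integral_filter_of_dominated_convergence
      (fun _ => 2 * (2 * (w 0 + 1)) * π) ?_ ?_ intervalIntegrable_const ?_
    · refine Eventually.of_forall fun r => Measurable.aestronglyMeasurable ?_
      have := measurable_arccos
      fun_prop
    · filter_upwards [hpos, hbdd, hself] with r h1 h2 h3
      refine Eventually.of_forall fun t ht => ?_
      rw [Set.uIoc_of_le (by norm_num)] at ht
      have h4 : 0 ≤ w r + r * t := by nlinarith [ht.1]
      have h5 : w r + r * t ≤ 2 * (w 0 + 1) := by nlinarith [ht.2]
      rw [norm_of_nonneg (mul_nonneg (by linarith) (arccos_nonneg _))]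
      exact mul_le_mul (by linarith) (arccos_le_pi _) (arccos_nonneg _) (by linarith)
    · refine Eventually.of_forall fun t _ => ?_
      have h1 : Tendsto (fun r => w r + r * t) (nhdsWithin 0 (Set.Ioi 0)) (nhds (w 0)) := by
        simpa using hw'.add (hid.mul_const t)
      have h2 : Tendsto (fun r => 2 * w r * t + r * (t ^ 2 + 1)) (nhdsWithin 0 (Set.Ioi 0))
          (nhds (2 * w 0 * t)) := by
        simpa using ((hw'.const_mul 2).mul_const t).add (hid.mul_const (t ^ 2 + 1))
      have h3 := h2.div (h1.const_mul 2) (by positivity)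
      rw [show 2 * w 0 * t / (2 * w 0) = t by field_simp] at h3
      exact (h1.const_mul 2).mul ((continuous_arccos.tendsto t).comp h3)
  rw [intervalIntegral.integral_const_mul, integral_arccos_neg_one_one,
    show 2 * w 0 * π = 2 * π * w 0 by ring] at key
  refine key.congr' ?_
  filter_upwards [hpos, hself] with r h1 h3
  have hsub := intervalIntegral.mul_integral_comp_add_mul (a := -1) (b := 1)
    (f := fun s => 2 * s * arccos ((s ^ 2 + (r ^ 2 - w r ^ 2)) / (2 * r * s))) (c := r) (d := w r)
  rw [show w r + r * -1 = w r - r by ring, mul_one] at hsub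
  rw [← hsub, inv_mul_cancel_left₀ h3.ne']
  refine intervalIntegral.integral_congr fun t ht => ?_
  rw [Set.uIcc_of_le (by norm_num)] at ht
  have h4 : 0 < w r + r * t := by nlinarith [ht.1]
  have h5 : (2 * w r * t + r * (t ^ 2 + 1)) / (2 * (w r + r * t)) =
      ((w r + r * t) ^ 2 + (r ^ 2 - w r ^ 2)) / (2 * r * (w r + r * t)) := by
    rw [div_eq_div_iff (by positivity) (by positivity)]
    ring
  simp only [h5]

/-- One-sided derivative at `0` of the area of the annulus between radii `w 0` and `w r - r`
plus the sector integral between radii `w r - r` and `w r + r`. -/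
theorem tendsto_inv_mul_annulus_add_sector {w : ℝ → ℝ} {w' : ℝ} (hw : HasDerivAt w w' 0)
    (hw0 : 0 < w 0) :
    Tendsto (fun r => r⁻¹ * (π * ((w r - r) ^ 2 - w 0 ^ 2) +
        ∫ s in (w r - r)..(w r + r),
          2 * s * arccos ((s ^ 2 + (r ^ 2 - w r ^ 2)) / (2 * r * s))))
      (nhdsWithin 0 (Set.Ioi 0)) (nhds (2 * π * w 0 * w')) := by
  have hd : HasDerivAt (fun r => π * (w r - r) ^ 2) (2 * π * w 0 * (w' - 1)) 0 := by
    refine (((hw.sub (hasDerivAt_id 0)).pow 2).const_mul π).congr_deriv ?_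
    simp
    ring
  have h1 := (hasDerivAt_iff_tendsto_slope_zero.1 hd).mono_left
    (nhdsWithin_mono 0 fun r (hr : 0 < r) => hr.ne')
  have h2 := h1.add (tendsto_inv_mul_sector_integral hw.continuousAt hw0)
  rw [show 2 * π * w 0 * (w' - 1) + 2 * π * w 0 = 2 * π * w 0 * w' by ring] at h2
  refine h2.congr fun r => ?_
  simp only [zero_add, sub_zero, smul_eq_mul]
  ring

/-- equations (44)+(45) of Appendix B: in the case `β > 1`,
`cos θ < −1/β`, the derivative at `r = 0` of the total bad-region area
`A(r) = π(φ^d(r)² − β²R₀²) + ∫_{φ^d(r)}^{φ^u(r)} 2s·arccos((s² + x(r))/(2rs)) ds`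
equals `−2πβ²R₀ cos θ`. -/
theorem total_bad_region_derivative_full_annulus_case
    (β R₀ θ : ℝ) (hβ : 1 < β) (hR₀ : 0 < R₀)
    (hθ : Real.cos θ < -(1 / β))
    (x φd φu : ℝ → ℝ)
    (hx : ∀ r : ℝ, x r = r ^ 2 - β ^ 2 * (R₀ ^ 2 - 2 * r * R₀ * Real.cos θ + r ^ 2))
    (hφd : ∀ r : ℝ, φd r = -r + Real.sqrt (r ^ 2 - x r))
    (hφu : ∀ r : ℝ, φu r = r + Real.sqrt (r ^ 2 - x r)) :
    Filter.Tendsto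
      (fun r => (1 / r) *
        (Real.pi * ((φd r) ^ 2 - β ^ 2 * R₀ ^ 2) +
          ∫ s in (φd r)..(φu r),
            2 * s * Real.arccos ((s ^ 2 + x r) / (2 * r * s))))
      (nhdsWithin 0 (Set.Ioi 0))
      (nhds (-(2 * Real.pi * β ^ 2 * R₀ * Real.cos θ))) := by
  have hsq : ∀ r, 0 ≤ r ^ 2 - x r := fun r => by
    rw [hx]
    nlinarith [mul_nonneg (sq_nonneg β) (sq_nonneg (r - R₀ * cos θ)),
      mul_nonneg (mul_nonneg (sq_nonneg β) (sq_nonneg R₀)) (sub_nonneg.2 (cos_sq_le_one θ))]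
  have hβR : 0 < β * R₀ := by positivity
  have hx0 : (0 : ℝ) ^ 2 - x 0 = (β * R₀) ^ 2 := by
    rw [hx]
    ring
  have hw0 : √((0 : ℝ) ^ 2 - x 0) = β * R₀ := by
    rw [hx0, sqrt_sq hβR.le]
  have hw : HasDerivAt (fun r => √(r ^ 2 - x r)) (-(β * cos θ)) 0 := by
    have hp : HasDerivAt (fun r => r ^ 2 - x r) (-(2 * β ^ 2 * R₀ * cos θ)) 0 := by
      have h := ((((hasDerivAt_id (0 : ℝ)).const_mul (-(2 * R₀ * cos θ))).add
        ((hasDerivAt_id (0 : ℝ)).pow 2)).const_add (R₀ ^ 2)).const_mul (β ^ 2)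
      refine (h.congr_deriv ?_).congr_of_eventuallyEq (Eventually.of_forall fun r => ?_)
      · simp
        ring
      · simp only [hx, Pi.add_apply, Pi.pow_apply, id]
        ring
    refine (hp.sqrt (by rw [hx0]; positivity)).congr_deriv ?_
    rw [hw0]
    field_simp
  have h := tendsto_inv_mul_annulus_add_sector hw (hw0 ▸ hβR)
  rw [hw0, show 2 * π * (β * R₀) * -(β * cos θ) = -(2 * π * β ^ 2 * R₀ * cos θ) by ring] at h
  refine h.congr fun r => ?_
  rw [sq_sqrt (hsq r), hφd, hφu, one_div, mul_pow, sub_sub_cancel, neg_add_eq_sub,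
    add_comm r]
end
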